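/- Defocusing case on the line, unboundedness above the critical mass: let p ∈ (2,6), α < 0 and μ > μ_ℝ. Then the NLS energy E_α is unbounded from below on H¹_μ(ℝ): for every M > 0 there exists u ∈ H¹_μ(ℝ) with E_α(u) < −M. -/

import Mathlib

open MeasureTheory Real Set Filter

/-- Membership in `H¹(ℝ)`: `u` is differentiable with derivative `u'`,
and both `u` and `u'` are square-integrable on `ℝ`. -/
def H1line (u u' : ℝ → ℝ) : Prop :=
  (∀ x, HasDerivAt u (u' x) x) ∧
  Integrable (fun x => (u x) ^ 2) ∧
  Integrable (fun x => (u' x) ^ 2)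

/-- The NLS energy with combined nonlinearities
`E_α(u) = ∫_ℝ (½|u'|² − (1/6)|u|⁶ − (α/p)|u|^p)`. -/
noncomputable def Eline (p α : ℝ) (u u' : ℝ → ℝ) : ℝ :=
  ∫ x, (1 / 2 * (u' x) ^ 2 - 1 / 6 * |u x| ^ 6 - α / p * |u x| ^ p)

theorem one_add_sq_le_two_mul_cosh (x : ℝ) : 1 + x ^ 2 ≤ 2 * cosh x := by
  have h1 : |x / 2| ≤ |sinh (x / 2)| := by
    rw [abs_sinh]
    exact self_le_sinh_iff.2 (abs_nonneg _)
  have h2 : (x / 2) ^ 2 ≤ sinh (x / 2) ^ 2 := sq_le_sq.2 h1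
  have h3 : cosh x = cosh (x / 2) ^ 2 + sinh (x / 2) ^ 2 := by
    rw [← cosh_two_mul]
    congr 1
    ring
  have h4 := cosh_sq (x / 2)
  nlinarith [sq_nonneg x]

theorem continuous_inv_cosh : Continuous fun x : ℝ => (cosh x)⁻¹ :=
  continuous_cosh.inv₀ fun x => (cosh_pos x).ne'

theorem inv_cosh_le_one (x : ℝ) : (cosh x)⁻¹ ≤ 1 :=
  inv_le_one_of_one_le₀ (one_le_cosh x)

theorem integrable_inv_cosh : Integrable fun x : ℝ => (cosh x)⁻¹ := by
  refine (integrable_inv_one_add_sq.const_mul 2).mono'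
    continuous_inv_cosh.aestronglyMeasurable (.of_forall fun x => ?_)
  have hc := cosh_pos x
  rw [norm_of_nonneg (inv_nonneg.2 hc.le), ← div_eq_mul_inv, inv_eq_one_div,
    div_le_div_iff₀ hc (by positivity)]
  linarith [one_add_sq_le_two_mul_cosh x]

theorem integrable_inv_cosh_pow_three : Integrable fun x : ℝ => (cosh x)⁻¹ ^ 3 := by
  refine integrable_inv_cosh.mono' (continuous_inv_cosh.pow 3).aestronglyMeasurable
    (.of_forall fun x => ?_)
  have hc : 0 ≤ (cosh x)⁻¹ := inv_nonneg.2 (cosh_pos x).le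
  rw [norm_of_nonneg (pow_nonneg hc 3)]
  exact pow_le_of_le_one hc (inv_cosh_le_one x) (by norm_num)

theorem integral_inv_cosh : ∫ x : ℝ, (cosh x)⁻¹ = π := by
  have hderiv (x : ℝ) : HasDerivAt (fun x => arctan (sinh x)) (cosh x)⁻¹ x := by
    convert (hasDerivAt_sinh x).arctan using 1
    have hc := (cosh_pos x).ne'
    rw [← cosh_sq']
    field_simp
  have htop : Tendsto (fun x => arctan (sinh x)) atTop (nhds (π / 2)) :=
    (tendsto_nhds_of_tendsto_nhdsWithin tendsto_arctan_atTop).comp sinhOrderIso.tendsto_atTop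
  have hbot : Tendsto (fun x => arctan (sinh x)) atBot (nhds (-(π / 2))) :=
    (tendsto_nhds_of_tendsto_nhdsWithin tendsto_arctan_atBot).comp sinhOrderIso.tendsto_atBot
  rw [integral_of_hasDerivAt_of_tendsto hderiv integrable_inv_cosh hbot htop]
  ring

theorem integral_inv_cosh_pow_three : ∫ x : ℝ, (cosh x)⁻¹ ^ 3 = π / 2 := by
  have hderiv (x : ℝ) : HasDerivAt (fun x => sinh x / cosh x ^ 2)
      (2 * (cosh x)⁻¹ ^ 3 - (cosh x)⁻¹) x := by
    have hc := (cosh_pos x).ne'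
    have hs : sinh x ^ 2 = cosh x ^ 2 - 1 := sinh_sq x
    refine ((hasDerivAt_sinh x).fun_div ((hasDerivAt_cosh x).fun_pow 2)
      (pow_ne_zero 2 hc)).congr_deriv ?_
    field_simp
    simp only [Nat.cast_ofNat, Nat.add_one_sub_one, pow_one]
    linear_combination (-2 * cosh x) * hs
  have hint : Integrable fun x : ℝ => sinh x / cosh x ^ 2 := by
    refine integrable_inv_cosh.mono' (Continuous.aestronglyMeasurable
      (continuous_sinh.div (continuous_cosh.pow 2) fun x => pow_ne_zero 2 (cosh_pos x).ne'))
      (.of_forall fun x => ?_)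
    have hc := cosh_pos x
    have hs : |sinh x| ≤ cosh x := abs_le_of_sq_le_sq (by rw [sinh_sq]; linarith) hc.le
    rw [Real.norm_eq_abs, abs_div, abs_of_pos (pow_pos hc 2), inv_eq_one_div,
      div_le_div_iff₀ (pow_pos hc 2) hc]
    nlinarith
  have h := integral_eq_zero_of_hasDerivAt_of_integrable hderiv
    ((integrable_inv_cosh_pow_three.const_mul 2).sub integrable_inv_cosh) hint
  rw [integral_sub (integrable_inv_cosh_pow_three.const_mul 2) integrable_inv_cosh,
    integral_const_mul, integral_inv_cosh] at h
  linarith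

/-- The quintic soliton profile of amplitude `b` and inverse width `k`. -/
noncomputable def soliton (b k x : ℝ) : ℝ := b * (√(cosh (k * x)))⁻¹

/-- The derivative of `soliton`. -/
noncomputable def solitonDeriv (b k x : ℝ) : ℝ :=
  -(b * k / 2) * (sinh (k * x) * (cosh (k * x))⁻¹ * (√(cosh (k * x)))⁻¹)

theorem hasDerivAt_soliton (b k x : ℝ) :
    HasDerivAt (soliton b k) (solitonDeriv b k x) x := by
  have hc := cosh_pos (k * x)
  have hs := sqrt_pos.2 hc
  have h1 : HasDerivAt (fun x => k * x) k x := by simpa using (hasDerivAt_id x).const_mul k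
  refine (((h1.cosh.sqrt hc.ne').inv hs.ne').const_mul b).congr_deriv ?_
  rw [solitonDeriv, sq_sqrt hc.le]
  field_simp

theorem soliton_sq (b k x : ℝ) : soliton b k x ^ 2 = b ^ 2 * (cosh (k * x))⁻¹ := by
  rw [soliton, mul_pow, inv_pow, sq_sqrt (cosh_pos _).le]

theorem abs_soliton_pow_six (b k x : ℝ) :
    |soliton b k x| ^ 6 = b ^ 6 * (cosh (k * x))⁻¹ ^ 3 := by
  rw [show (6 : ℕ) = 2 * 3 from rfl, pow_mul, sq_abs, soliton_sq]
  ring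

theorem solitonDeriv_sq (b k x : ℝ) : solitonDeriv b k x ^ 2 =
    b ^ 2 * k ^ 2 / 4 * ((cosh (k * x))⁻¹ - (cosh (k * x))⁻¹ ^ 3) := by
  have hc := cosh_pos (k * x)
  rw [solitonDeriv, mul_pow, mul_pow, mul_pow, inv_pow (√_), sq_sqrt hc.le, sinh_sq]
  field_simp
  ring

theorem abs_soliton_rpow_le {b : ℝ} (hb : 0 ≤ b) (k x : ℝ) {p : ℝ} (hp : 2 ≤ p) :
    |soliton b k x| ^ p ≤ b ^ p * (cosh (k * x))⁻¹ := by
  have hc := cosh_pos (k * x)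
  have hs := sqrt_pos.2 hc
  have hs1 : (√(cosh (k * x)))⁻¹ ≤ 1 :=
    inv_le_one_of_one_le₀ (one_le_sqrt.2 (one_le_cosh _))
  have h := rpow_le_rpow_of_exponent_ge (inv_pos.2 hs) hs1 hp
  rw [rpow_two, inv_pow, sq_sqrt hc.le] at h
  rw [soliton, abs_of_nonneg (mul_nonneg hb (inv_nonneg.2 hs.le)),
    mul_rpow hb (inv_nonneg.2 hs.le)]
  exact mul_le_mul_of_nonneg_left h (rpow_nonneg hb p)

theorem integrable_abs_soliton_rpow {b : ℝ} (hb : 0 ≤ b) {k p : ℝ} (hk : k ≠ 0) (hp : 2 ≤ p) :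
    Integrable fun x => |soliton b k x| ^ p := by
  have hcont : Continuous (soliton b k) :=
    continuous_iff_continuousAt.2 fun x => (hasDerivAt_soliton b k x).continuousAt
  refine ((integrable_inv_cosh.comp_mul_left' hk).const_mul (b ^ p)).mono'
    (hcont.abs.rpow_const fun _ => .inr (by linarith)).aestronglyMeasurable
    (.of_forall fun x => ?_)
  rw [norm_of_nonneg (rpow_nonneg (abs_nonneg _) p)]
  exact abs_soliton_rpow_le hb k x hp

theorem integrable_solitonDeriv_sq (b : ℝ) {k : ℝ} (hk : k ≠ 0) :
    Integrable fun x => solitonDeriv b k x ^ 2 := by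
  simp only [solitonDeriv_sq]
  exact ((integrable_inv_cosh.comp_mul_left' hk).sub
    (integrable_inv_cosh_pow_three.comp_mul_left' hk)).const_mul _

theorem H1line_soliton (b : ℝ) {k : ℝ} (hk : k ≠ 0) :
    H1line (soliton b k) (solitonDeriv b k) := by
  refine ⟨hasDerivAt_soliton b k, ?_, integrable_solitonDeriv_sq b hk⟩
  simp only [soliton_sq]
  exact (integrable_inv_cosh.comp_mul_left' hk).const_mul _

theorem integral_inv_cosh_mul {k : ℝ} (hk : 0 < k) : ∫ x : ℝ, (cosh (k * x))⁻¹ = π / k := by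
  rw [Measure.integral_comp_mul_left (fun x => (cosh x)⁻¹) k, integral_inv_cosh,
    abs_of_pos (inv_pos.2 hk), smul_eq_mul]
  ring

theorem integral_inv_cosh_mul_pow_three {k : ℝ} (hk : 0 < k) :
    ∫ x : ℝ, (cosh (k * x))⁻¹ ^ 3 = π / (2 * k) := by
  rw [Measure.integral_comp_mul_left (fun x => (cosh x)⁻¹ ^ 3) k, integral_inv_cosh_pow_three,
    abs_of_pos (inv_pos.2 hk), smul_eq_mul]
  field_simp

theorem integral_soliton_sq (b : ℝ) {k : ℝ} (hk : 0 < k) :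
    ∫ x, soliton b k x ^ 2 = b ^ 2 * (π / k) := by
  simp only [soliton_sq]
  rw [integral_const_mul, integral_inv_cosh_mul hk]

theorem Eline_soliton_le {p α b k : ℝ} (hp : 2 ≤ p) (hα : α ≤ 0) (hb : 0 ≤ b) (hk : 0 < k) :
    Eline p α (soliton b k) (solitonDeriv b k) ≤
      b ^ 2 * k * π / 16 - b ^ 6 * π / (12 * k) + -α / p * b ^ p * (π / k) := by
  have h1 := integrable_inv_cosh.comp_mul_left' hk.ne'
  have h3 := integrable_inv_cosh_pow_three.comp_mul_left' hk.ne'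
  have hα' : 0 ≤ -α / p := div_nonneg (by linarith) (by linarith)
  have h6 : Integrable fun x => |soliton b k x| ^ 6 := by
    simp only [abs_soliton_pow_six]
    exact h3.const_mul _
  have hint : Integrable fun x => 1 / 2 * solitonDeriv b k x ^ 2 - 1 / 6 * |soliton b k x| ^ 6
      - α / p * |soliton b k x| ^ p :=
    (((integrable_solitonDeriv_sq b hk.ne').const_mul _).sub (h6.const_mul _)).sub
      ((integrable_abs_soliton_rpow hb hk.ne' hp).const_mul _)
  calc Eline p α (soliton b k) (solitonDeriv b k)
    _ ≤ ∫ x, ((b ^ 2 * k ^ 2 / 8 + -α / p * b ^ p) * (cosh (k * x))⁻¹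
        - (b ^ 2 * k ^ 2 / 8 + b ^ 6 / 6) * (cosh (k * x))⁻¹ ^ 3) := by
      refine integral_mono hint ((h1.const_mul _).sub (h3.const_mul _)) fun x => ?_
      have h := mul_le_mul_of_nonneg_left (abs_soliton_rpow_le hb k x hp) hα'
      simp only [solitonDeriv_sq, abs_soliton_pow_six]
      have h' : -(α / p * |soliton b k x| ^ p) = -α / p * |soliton b k x| ^ p := by ring
      linarith
    _ = _ := by
      rw [integral_sub (h1.const_mul _) (h3.const_mul _), integral_const_mul, integral_const_mul,
        integral_inv_cosh_mul hk, integral_inv_cosh_mul_pow_three hk]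
      field_simp
      ring

theorem exists_mul_rpow_sub_mul_sq_lt {A B s : ℝ} (hB : 0 < B) (hs : s < 2) (M : ℝ) :
    ∃ k : ℝ, 0 < k ∧ A * k ^ s - B * k ^ 2 < M := by
  have h0 : Tendsto (fun k : ℝ => A * k ^ (-(2 - s)) - B) atTop (nhds (A * 0 - B)) :=
    ((tendsto_rpow_neg_atTop (by linarith)).const_mul A).sub_const B
  have h1 : Tendsto (fun k : ℝ => k ^ 2 * (A * k ^ (-(2 - s)) - B)) atTop atBot :=
    (tendsto_pow_atTop two_ne_zero).atTop_mul_neg (by linarith) h0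
  obtain ⟨k, hk, hkM⟩ := ((eventually_gt_atTop 0).and (h1.eventually_lt_atBot M)).exists
  refine ⟨k, hk, ?_⟩
  have h2 : k ^ s = k ^ 2 * k ^ (-(2 - s)) := by
    rw [← rpow_two, ← rpow_add hk]
    congr 1
    ring
  rw [h2]
  linarith

/-- Defocusing case on the line, unboundedness above the critical mass:
for `p ∈ (2,6)`, `α < 0` and `μ > μ_ℝ`, for every `M > 0` there exists
`u ∈ H¹_μ(ℝ)` with `E_α(u) < −M`. -/
theorem defocusing_unbounded_line (p α μ : ℝ)
    (hp : 2 < p) (hp' : p < 6) (hα : α < 0)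
    (hμ : Real.pi * Real.sqrt 3 / 2 < μ) :
    ∀ M : ℝ, 0 < M → ∃ u u' : ℝ → ℝ,
      H1line u u' ∧ (∫ x, (u x) ^ 2) = μ ∧ Eline p α u u' < -M := by
  intro M _
  have hπ := pi_pos
  have hμ0 : 0 < μ := lt_trans (by positivity) hμ
  have hμ2 : π ^ 2 * 3 / 4 < μ ^ 2 := by
    have h := pow_lt_pow_left₀ hμ (by positivity) two_ne_zero
    rwa [div_pow, mul_pow, sq_sqrt (by norm_num), show (2 : ℝ) ^ 2 = 4 by norm_num] at h
  have hB : 0 < μ ^ 3 / (12 * π ^ 2) - μ / 16 := by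
    have : μ ^ 3 / (12 * π ^ 2) - μ / 16 = μ * (μ ^ 2 - π ^ 2 * 3 / 4) / (12 * π ^ 2) := by
      field_simp
      ring
    rw [this]
    exact div_pos (mul_pos hμ0 (sub_pos.2 hμ2)) (by positivity)
  obtain ⟨k, hk, hkM⟩ := exists_mul_rpow_sub_mul_sq_lt (A := -α / p * (μ / π) ^ (p / 2) * π)
    (s := p / 2 - 1) hB (by linarith) (-M)
  have hb2 : √(μ / π * k) ^ 2 = μ / π * k := sq_sqrt (by positivity)
  have hb6 : √(μ / π * k) ^ 6 = (μ / π * k) ^ 3 := by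
    rw [show (6 : ℕ) = 2 * 3 from rfl, pow_mul, hb2]
  have hbp : √(μ / π * k) ^ p = (μ / π) ^ (p / 2) * (k ^ (p / 2 - 1) * k) := by
    rw [← rpow_add_one hk.ne', sub_add_cancel, ← mul_rpow (by positivity) hk.le, sqrt_eq_rpow,
      ← rpow_mul (by positivity)]
    congr 1
    ring
  refine ⟨soliton √(μ / π * k) k, solitonDeriv √(μ / π * k) k, H1line_soliton _ hk.ne', ?_, ?_⟩
  · rw [integral_soliton_sq _ hk, hb2]
    field_simp
  · refine (Eline_soliton_le hp.le hα.le (sqrt_nonneg _) hk).trans_lt ?_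
    rw [hb2, hb6, hbp]
    refine lt_of_eq_of_lt ?_ hkM
    field_simp
    ring
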